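/- For any partition λ with at most N parts, the sum of the Demazure atoms 𝒜_α(x_1,…,x_N) over all distinct rearrangements α of λ (i.e., over the S_N-orbit of λ) equals the Schur polynomial s_λ(x_1,…,x_N). -/

import Mathlib

noncomputable section


open MvPolynomial

/-- The field of rational functions in `N` variables over `ℚ`. -/
abbrev KK (N : ℕ) : Type := FractionRing (MvPolynomial (Fin N) ℚ)

/-- The variable `x_i` as a rational function. -/
def XV {N : ℕ} (i : Fin N) : KK N :=
  algebraMap (MvPolynomial (Fin N) ℚ) (KK N) (X i)

/-- The field automorphism `s` exchanging the variables `x_i` and `x_j`. -/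
def swapK {N : ℕ} (i j : Fin N) : KK N →+* KK N :=
  IsFractionRing.lift (g := (algebraMap (MvPolynomial (Fin N) ℚ) (KK N)).comp
      (rename (Equiv.swap i j)).toRingHom)
    (by
      rw [RingHom.coe_comp]
      exact (IsFractionRing.injective _ _).comp
        (rename_injective _ (Equiv.swap i j).injective))

/-- The Demazure (isobaric divided difference) operator
`π(f) = (x_i f - s(x_i f)) / (x_i - x_j)` (for `j = i+1`). -/
def dem {N : ℕ} (i j : Fin N) (f : KK N) : KK N :=
  (XV i * f - swapK i j (XV i * f)) / (XV i - XV j)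

/-- The subalgebra of Laurent polynomials: generated by the variables and
their inverses. -/
def LaurentSub (N : ℕ) : Subalgebra ℚ (KK N) :=
  Algebra.adjoin ℚ (Set.range (XV (N := N)) ∪ Set.range (fun i => (XV (N := N) i)⁻¹))

/-- The Demazure operator `π_i` (0-based index), identity if out of range. -/
def piNat {N : ℕ} (i : ℕ) (f : KK N) : KK N :=
  if h : i + 1 < N then dem ⟨i, by omega⟩ ⟨i + 1, h⟩ f else f

/-- The atom operator `π̂_i = π_i - id`. -/
def hatpiNat {N : ℕ} (i : ℕ) (f : KK N) : KK N := piNat i f - f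

/-- Apply `π̂_{j_1} ∘ ⋯ ∘ π̂_{j_d}` for a word `[j_1, …, j_d]`. -/
def applyHatWord {N : ℕ} (l : List ℕ) (f : KK N) : KK N := l.foldr hatpiNat f

/-- The simple transposition `s_i = (i, i+1)` (0-based), identity if out of
range. -/
def swapPerm (N i : ℕ) : Equiv.Perm (Fin N) :=
  if h : i + 1 < N then Equiv.swap ⟨i, by omega⟩ ⟨i + 1, h⟩ else 1

/-- The permutation `s_{j_1} s_{j_2} ⋯ s_{j_d}` of a word `[j_1, …, j_d]`. -/
def permOfWord (N : ℕ) (l : List ℕ) : Equiv.Perm (Fin N) :=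
  (l.map (swapPerm N)).prod

/-- The Coxeter length of `w`: its number of inversions. -/
def invNum {N : ℕ} (w : Equiv.Perm (Fin N)) : ℕ :=
  ((Finset.univ : Finset (Fin N × Fin N)).filter fun p =>
    p.1 < p.2 ∧ w p.2 < w p.1).card

/-- The action of `w ∈ S_N` on weight vectors:
`w(β) = (β_{w⁻¹(1)}, …, β_{w⁻¹(N)})`. -/
def permVec {N : ℕ} (w : Equiv.Perm (Fin N)) (β : Fin N → ℕ) : Fin N → ℕ :=
  fun i => β (w⁻¹ i)

/-- The Schur polynomial as a bialternant. -/
def schur {N : ℕ} (lam : Fin N → ℕ) : KK N :=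
  (Matrix.of fun i j : Fin N => XV i ^ (lam j + (N - 1 - (j : ℕ)))).det /
    (Matrix.of fun i j : Fin N => XV i ^ (N - 1 - (j : ℕ))).det

/-- The automorphism of the field of rational functions permuting the variables by `w`. -/
def permK {N : ℕ} (w : Equiv.Perm (Fin N)) : KK N →+* KK N :=
  IsFractionRing.lift (g := (algebraMap (MvPolynomial (Fin N) ℚ) (KK N)).comp
      (rename w).toRingHom)
    (by
      rw [RingHom.coe_comp]
      exact (IsFractionRing.injective _ _).comp (rename_injective _ w.injective))

theorem permK_algebraMap {N : ℕ} (w : Equiv.Perm (Fin N)) (p : MvPolynomial (Fin N) ℚ) :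
    permK w (algebraMap _ (KK N) p) = algebraMap _ (KK N) (rename w p) := by
  rw [permK, IsFractionRing.lift_algebraMap]
  rfl

theorem permK_XV {N : ℕ} (w : Equiv.Perm (Fin N)) (i : Fin N) :
    permK w (XV i) = XV (w i) := by
  rw [XV, permK_algebraMap, rename_X, XV]

theorem permK_mul {N : ℕ} (w v : Equiv.Perm (Fin N)) (f : KK N) :
    permK (w * v) f = permK w (permK v f) := by
  have h : permK (w * v) = (permK w).comp (permK v) := by
    refine IsLocalization.ringHom_ext (nonZeroDivisors (MvPolynomial (Fin N) ℚ))
      (RingHom.ext fun p => ?_)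
    simp only [RingHom.comp_apply, permK_algebraMap, rename_rename, Equiv.Perm.coe_mul]
  rw [h, RingHom.comp_apply]

theorem permK_one {N : ℕ} (f : KK N) : permK (1 : Equiv.Perm (Fin N)) f = f := by
  have h : permK (1 : Equiv.Perm (Fin N)) = RingHom.id (KK N) := by
    refine IsLocalization.ringHom_ext (nonZeroDivisors (MvPolynomial (Fin N) ℚ))
      (RingHom.ext fun p => ?_)
    simp only [RingHom.comp_apply, permK_algebraMap, Equiv.Perm.coe_one, rename_id,
      RingHom.id_apply, AlgHom.id_apply]
  rw [h, RingHom.id_apply]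

theorem XV_injective {N : ℕ} : Function.Injective (XV (N := N)) :=
  (IsFractionRing.injective (MvPolynomial (Fin N) ℚ) (KK N)).comp (X_injective)

theorem XV_sub_ne_zero {N : ℕ} {i j : Fin N} (h : i ≠ j) : XV i - XV j ≠ 0 :=
  sub_ne_zero.2 (XV_injective.ne h)

theorem val_swapPerm {N i : ℕ} (h : i + 1 < N) (k : Fin N) :
    (swapPerm N i k : ℕ) = if (k : ℕ) = i then i + 1 else if (k : ℕ) = i + 1 then i else k := by
  simp only [swapPerm, h, dif_pos, Equiv.swap_apply_def, Fin.ext_iff]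
  split_ifs <;> rfl

theorem swapPerm_left {N i : ℕ} (h : i + 1 < N) :
    swapPerm N i ⟨i, by omega⟩ = ⟨i + 1, h⟩ := by
  simp [Fin.ext_iff, val_swapPerm h]

theorem swapPerm_right {N i : ℕ} (h : i + 1 < N) :
    swapPerm N i ⟨i + 1, h⟩ = ⟨i, by omega⟩ := by
  simp [Fin.ext_iff, val_swapPerm h]

theorem swapPerm_of_ne {N i k : ℕ} (h : i + 1 < N) (hk : k < N) (h₁ : k ≠ i) (h₂ : k ≠ i + 1) :
    swapPerm N i ⟨k, hk⟩ = ⟨k, hk⟩ := by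
  simp [Fin.ext_iff, val_swapPerm h, h₁, h₂]

theorem swapPerm_mul_self (N i : ℕ) : swapPerm N i * swapPerm N i = 1 := by
  unfold swapPerm
  split_ifs
  · exact Equiv.swap_mul_self _ _
  · exact one_mul 1

theorem swapPerm_swapPerm {N : ℕ} (i : ℕ) (k : Fin N) : swapPerm N i (swapPerm N i k) = k := by
  rw [← Equiv.Perm.mul_apply, swapPerm_mul_self, Equiv.Perm.one_apply]

theorem swapPerm_inv (N i : ℕ) : (swapPerm N i)⁻¹ = swapPerm N i :=
  inv_eq_of_mul_eq_one_right (swapPerm_mul_self N i)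

theorem swapPerm_commute {N i j : ℕ} (hij : i + 1 < j) (hj : j + 1 < N) :
    swapPerm N i * swapPerm N j = swapPerm N j * swapPerm N i := by
  have hi : i + 1 < N := by omega
  ext k
  simp only [Equiv.Perm.mul_apply, val_swapPerm hi, val_swapPerm hj]
  split_ifs <;> omega

theorem swapPerm_braid {N i : ℕ} (hj : i + 1 + 1 < N) :
    swapPerm N i * swapPerm N (i + 1) * swapPerm N i =
      swapPerm N (i + 1) * swapPerm N i * swapPerm N (i + 1) := by
  have hi : i + 1 < N := by omega
  ext k
  simp only [Equiv.Perm.mul_apply, val_swapPerm hi, val_swapPerm hj]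
  split_ifs <;> omega

theorem hatpiNat_eq {N i : ℕ} (h : i + 1 < N) (f : KK N) :
    hatpiNat i f = XV ⟨i + 1, h⟩ * (f - permK (swapPerm N i) f) /
      (XV ⟨i, by omega⟩ - XV ⟨i + 1, h⟩) := by
  have hne : (XV ⟨i, by omega⟩ - XV ⟨i + 1, h⟩ : KK N) ≠ 0 :=
    XV_sub_ne_zero (by simp [Fin.ext_iff])
  have hs : swapK ⟨i, by omega⟩ ⟨i + 1, h⟩ = permK (swapPerm N i) := by
    simp only [swapPerm, h, dif_pos]
    rfl
  rw [hatpiNat, piNat, dif_pos h, dem, hs, map_mul, permK_XV, swapPerm_left h, div_sub' hne]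
  congr 1
  ring

theorem hatpiNat_sum {N i : ℕ} (h : i + 1 < N) {ι : Type*} (s : Finset ι) (f : ι → KK N) :
    hatpiNat i (∑ a ∈ s, f a) = ∑ a ∈ s, hatpiNat i (f a) := by
  simp only [hatpiNat_eq h, map_sum, ← Finset.sum_sub_distrib, Finset.mul_sum, Finset.sum_div]

theorem hatpiNat_zero {N i : ℕ} (h : i + 1 < N) : hatpiNat i (0 : KK N) = 0 := by
  simp [hatpiNat_eq h]

theorem hatpiNat_eq_zero_iff {N i : ℕ} (h : i + 1 < N) (f : KK N) :
    hatpiNat i f = 0 ↔ permK (swapPerm N i) f = f := by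
  have hX : (XV ⟨i + 1, h⟩ : KK N) ≠ 0 := by
    rw [XV, Ne, FaithfulSMul.algebraMap_eq_zero_iff]
    exact X_ne_zero _
  have hne : (XV ⟨i, by omega⟩ - XV ⟨i + 1, h⟩ : KK N) ≠ 0 :=
    XV_sub_ne_zero (by simp [Fin.ext_iff])
  rw [hatpiNat_eq h, div_eq_zero_iff, or_iff_left hne, mul_eq_zero, or_iff_right hX, sub_eq_zero,
    eq_comm]

theorem divided_difference_sq {K : Type*} [Field K] (s : K →+* K) (x y f : K) (hxy : x - y ≠ 0)
    (hs : ∀ a, s (s a) = a) (sx : s x = y) (sy : s y = x) (D : K → K)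
    (hD : ∀ a, D a = y * (a - s a) / (x - y)) : D (D f) = -D f := by
  have h1 : y - x ≠ 0 := by rwa [← neg_ne_zero, neg_sub]
  simp only [hD, map_div₀, map_mul, map_sub, sx, sy, hs]
  generalize s f = a
  field_simp
  ring

theorem divided_difference_comm {K : Type*} [Field K] (s t : K →+* K) (x y z u f : K)
    (hxy : x - y ≠ 0) (hzu : z - u ≠ 0) (hst : ∀ a, s (t a) = t (s a))
    (sz : s z = z) (su : s u = u) (tx : t x = x) (ty : t y = y)
    (D E : K → K) (hD : ∀ a, D a = y * (a - s a) / (x - y))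
    (hE : ∀ a, E a = u * (a - t a) / (z - u)) : D (E f) = E (D f) := by
  simp only [hD, hE, map_div₀, map_mul, map_sub, sz, su, tx, ty, hst]
  generalize t (s f) = a, s f = b, t f = c
  field_simp
  ring

theorem divided_difference_braid {K : Type*} [Field K] (s t : K →+* K) (x y z f : K)
    (hxy : x - y ≠ 0) (hyz : y - z ≠ 0) (hxz : x - z ≠ 0)
    (hs : ∀ a, s (s a) = a) (ht : ∀ a, t (t a) = a) (hst : ∀ a, s (t (s a)) = t (s (t a)))
    (sx : s x = y) (sy : s y = x) (sz : s z = z) (tx : t x = x) (ty : t y = z) (tz : t z = y)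
    (D E : K → K) (hD : ∀ a, D a = y * (a - s a) / (x - y))
    (hE : ∀ a, E a = z * (a - t a) / (y - z)) :
    D (E (D f)) = E (D (E f)) := by
  have h1 : y - x ≠ 0 := by rwa [← neg_ne_zero, neg_sub]
  have h2 : z - y ≠ 0 := by rwa [← neg_ne_zero, neg_sub]
  simp only [hD, hE, map_div₀, map_mul, map_sub, sx, sy, sz, tx, ty, tz, hs, ht, hst]
  generalize t (s (t f)) = a, s (t f) = b, t (s f) = c, s f = d, t f = e
  field_simp
  ring

theorem permK_swapPerm_swapPerm {N : ℕ} (i : ℕ) (f : KK N) :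
    permK (swapPerm N i) (permK (swapPerm N i) f) = f := by
  rw [← permK_mul, swapPerm_mul_self, permK_one]

theorem hatpiNat_hatpiNat {N i : ℕ} (h : i + 1 < N) (f : KK N) :
    hatpiNat i (hatpiNat i f) = -hatpiNat i f :=
  divided_difference_sq (permK (swapPerm N i)) (XV ⟨i, by omega⟩) (XV ⟨i + 1, h⟩) f
    (XV_sub_ne_zero (by simp [Fin.ext_iff])) (permK_swapPerm_swapPerm i)
    (by rw [permK_XV, swapPerm_left h]) (by rw [permK_XV, swapPerm_right h]) _ (hatpiNat_eq h)

theorem hatpiNat_comm {N i j : ℕ} (hij : i + 1 < j) (hj : j + 1 < N) (f : KK N) :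
    hatpiNat i (hatpiNat j f) = hatpiNat j (hatpiNat i f) := by
  have hi : i + 1 < N := by omega
  refine divided_difference_comm (permK (swapPerm N i)) (permK (swapPerm N j))
    (XV ⟨i, by omega⟩) (XV ⟨i + 1, hi⟩) (XV ⟨j, by omega⟩) (XV ⟨j + 1, hj⟩) f
    (XV_sub_ne_zero (by simp [Fin.ext_iff])) (XV_sub_ne_zero (by simp [Fin.ext_iff]))
    (fun a => by rw [← permK_mul, swapPerm_commute hij hj, permK_mul]) ?_ ?_ ?_ ?_ _ _
    (hatpiNat_eq hi) (hatpiNat_eq hj)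
  · rw [permK_XV, swapPerm_of_ne hi _ (by omega) (by omega)]
  · rw [permK_XV, swapPerm_of_ne hi _ (by omega) (by omega)]
  · rw [permK_XV, swapPerm_of_ne hj _ (by omega) (by omega)]
  · rw [permK_XV, swapPerm_of_ne hj _ (by omega) (by omega)]

theorem hatpiNat_braid {N i : ℕ} (hj : i + 1 + 1 < N) (f : KK N) :
    hatpiNat i (hatpiNat (i + 1) (hatpiNat i f)) =
      hatpiNat (i + 1) (hatpiNat i (hatpiNat (i + 1) f)) := by
  have hi : i + 1 < N := by omega
  refine divided_difference_braid (permK (swapPerm N i)) (permK (swapPerm N (i + 1)))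
    (XV ⟨i, by omega⟩) (XV ⟨i + 1, hi⟩) (XV ⟨i + 1 + 1, hj⟩) f
    (XV_sub_ne_zero (by simp [Fin.ext_iff])) (XV_sub_ne_zero (by simp [Fin.ext_iff]))
    (XV_sub_ne_zero (by simp [Fin.ext_iff, Nat.add_assoc]))
    (permK_swapPerm_swapPerm i) (permK_swapPerm_swapPerm (i + 1))
    (fun a => by simp only [← permK_mul, ← mul_assoc, swapPerm_braid hj]) ?_ ?_ ?_ ?_ ?_ ?_ _ _
    (hatpiNat_eq hi) (hatpiNat_eq hj)
  · rw [permK_XV, swapPerm_left hi]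
  · rw [permK_XV, swapPerm_right hi]
  · rw [permK_XV, swapPerm_of_ne hi _ (by omega) (by omega)]
  · rw [permK_XV, swapPerm_of_ne hj _ (by omega) (by omega)]
  · rw [permK_XV, swapPerm_left hj]
  · rw [permK_XV, swapPerm_right hj]

/-- The number of pairs of positions at which the entries of `α` strictly increase. -/
def ascNum {N : ℕ} (α : Fin N → ℕ) : ℕ :=
  ((Finset.univ : Finset (Fin N × Fin N)).filter fun p => p.1 < p.2 ∧ α p.1 < α p.2).card

theorem ascNum_comp_swapPerm {N i : ℕ} (h : i + 1 < N) {α : Fin N → ℕ}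
    (hα : α ⟨i + 1, h⟩ < α ⟨i, by omega⟩) : ascNum (α ∘ swapPerm N i) = ascNum α + 1 := by
  set s := swapPerm N i with hs
  have key : ((Finset.univ : Finset (Fin N × Fin N)).filter fun p =>
        p.1 < p.2 ∧ (α ∘ s) p.1 < (α ∘ s) p.2) =
      insert (⟨i, by omega⟩, ⟨i + 1, h⟩) (((Finset.univ : Finset (Fin N × Fin N)).filter fun p =>
        p.1 < p.2 ∧ α p.1 < α p.2).map (s.prodCongr s).toEmbedding) := by
    ext ⟨p, q⟩
    rw [Finset.mem_insert, Finset.mem_map_equiv]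
    have hsymm : s.symm = s := swapPerm_inv N i
    simp only [Finset.mem_filter, Finset.mem_univ, true_and, Function.comp_apply, Prod.mk.injEq,
      Equiv.prodCongr_symm, Equiv.prodCongr_apply, Prod.map_apply, hsymm]
    by_cases h₁ : p = ⟨i, by omega⟩ ∧ q = ⟨i + 1, h⟩
    · obtain ⟨rfl, rfl⟩ := h₁
      simp [hs, swapPerm_left h, swapPerm_right h, hα]
    by_cases h₂ : p = ⟨i + 1, h⟩ ∧ q = ⟨i, by omega⟩
    · obtain ⟨rfl, rfl⟩ := h₂
      simp [hs, swapPerm_left h, swapPerm_right h, hα.le]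
    have hlt : p < q ↔ s p < s q := by
      simp only [Fin.ext_iff] at h₁ h₂
      rw [Fin.lt_def, Fin.lt_def, val_swapPerm h, val_swapPerm h]
      split_ifs <;> omega
    rw [or_iff_right h₁, hlt]
  rw [ascNum, key, Finset.card_insert_of_notMem, Finset.card_map, ascNum]
  rw [Finset.mem_map_equiv]
  have hsymm : s.symm = s := swapPerm_inv N i
  have h₁ : s ⟨i, by omega⟩ = ⟨i + 1, h⟩ := swapPerm_left h
  have h₂ : s ⟨i + 1, h⟩ = ⟨i, by omega⟩ := swapPerm_right h
  simp [hsymm, h₁, h₂]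

theorem comp_swapPerm_comp_swapPerm {N : ℕ} (i : ℕ) (α : Fin N → ℕ) :
    (α ∘ swapPerm N i) ∘ swapPerm N i = α := by
  ext k
  simp only [Function.comp_apply, swapPerm_swapPerm]

theorem ascNum_comp_swapPerm_of_lt {N i : ℕ} (h : i + 1 < N) {α : Fin N → ℕ}
    (hα : α ⟨i, by omega⟩ < α ⟨i + 1, h⟩) : ascNum α = ascNum (α ∘ swapPerm N i) + 1 := by
  conv_lhs => rw [← comp_swapPerm_comp_swapPerm i α]
  apply ascNum_comp_swapPerm h
  simpa only [Function.comp_apply, swapPerm_left h, swapPerm_right h]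

theorem comp_swapPerm_eq_self {N i : ℕ} (h : i + 1 < N) {α : Fin N → ℕ}
    (hα : α ⟨i, by omega⟩ = α ⟨i + 1, h⟩) : α ∘ swapPerm N i = α := by
  ext k
  simp only [swapPerm, h, dif_pos, Function.comp_apply, Equiv.swap_apply_def]
  split_ifs with h₁ h₂
  · rw [h₁, hα]
  · rw [h₂, hα]
  · rfl

theorem ascNum_comp_swapPerm_le {N i : ℕ} (h : i + 1 < N) (α : Fin N → ℕ) :
    ascNum (α ∘ swapPerm N i) ≤ ascNum α + 1 := by
  rcases lt_trichotomy (α ⟨i, by omega⟩) (α ⟨i + 1, h⟩) with hα | hα | hα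
  · have := ascNum_comp_swapPerm_of_lt h hα
    omega
  · rw [comp_swapPerm_eq_self h hα]
    omega
  · exact (ascNum_comp_swapPerm h hα).le

theorem ascNum_of_antitone {N : ℕ} {α : Fin N → ℕ} (hα : Antitone α) : ascNum α = 0 := by
  rw [ascNum, Finset.card_eq_zero, Finset.filter_eq_empty_iff]
  rintro ⟨p, q⟩ - ⟨h₁, h₂⟩
  exact absurd (hα h₁.le) (not_le.2 h₂)

theorem antitone_of_adjacent {N : ℕ} {α : Fin N → ℕ}
    (hα : ∀ (i : ℕ) (h : i + 1 < N), α ⟨i + 1, h⟩ ≤ α ⟨i, by omega⟩) : Antitone α := by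
  cases N with
  | zero => exact fun a => a.elim0
  | succ n => exact Fin.antitone_iff_succ_le.2 fun i => hα i (by omega)

theorem eq_of_antitone_comp_perm {N : ℕ} {lam : Fin N → ℕ} (hlam : Antitone lam)
    {w : Equiv.Perm (Fin N)} (hw : Antitone (lam ∘ w)) : lam ∘ w = lam := by
  have h := Tuple.unique_monotone (f := OrderDual.toDual ∘ lam) (σ := w) (τ := 1)
    (fun _ _ hab => hw hab) (fun _ _ hab => hlam hab)
  exact h

theorem invNum_eq_ascNum {N : ℕ} (w : Equiv.Perm (Fin N)) :
    invNum w = ascNum fun k => N - (w k : ℕ) := by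
  unfold invNum ascNum
  congr 1
  refine Finset.filter_congr fun p _ => and_congr_right fun _ => ?_
  have h₁ := (w p.1).isLt
  have h₂ := (w p.2).isLt
  rw [Fin.lt_def]
  dsimp only
  omega

theorem invNum_permOfWord_le {N : ℕ} (l : List ℕ) (hl : ∀ j ∈ l, j + 1 < N) :
    invNum (permOfWord N l) ≤ l.length := by
  induction l using List.reverseRecOn with
  | nil =>
    rw [List.length_nil, Nat.le_zero, invNum_eq_ascNum]
    refine ascNum_of_antitone fun a b hab => ?_
    simp only [permOfWord, List.map_nil, List.prod_nil, Equiv.Perm.one_apply]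
    exact Nat.sub_le_sub_left hab N
  | append_singleton l j ih =>
    have hj : j + 1 < N := hl j (by simp)
    have ih := ih fun k hk => hl k (by simp [hk])
    have h := ascNum_comp_swapPerm_le hj fun k => N - (permOfWord N l k : ℕ)
    have e : permOfWord N (l ++ [j]) = permOfWord N l * swapPerm N j := by
      simp [permOfWord]
    rw [invNum_eq_ascNum] at ih
    rw [invNum_eq_ascNum, e, List.length_append, List.length_singleton]
    exact h.trans (by omega)

theorem permVec_eq_comp {N : ℕ} (w : Equiv.Perm (Fin N)) (β : Fin N → ℕ) :
    permVec w β = β ∘ ⇑(w⁻¹) := rfl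

theorem permVec_permOfWord_cons {N : ℕ} (j : ℕ) (l : List ℕ) (β : Fin N → ℕ) :
    permVec (permOfWord N (j :: l)) β = permVec (permOfWord N l) β ∘ swapPerm N j := by
  rw [permVec_eq_comp, permVec_eq_comp, permOfWord, List.map_cons, List.prod_cons, mul_inv_rev,
    swapPerm_inv]
  rfl

/-- Every rearrangement of `lam` is reached from it by a word of length `ascNum α`. -/
theorem exists_word {N : ℕ} {lam : Fin N → ℕ} (hlam : Antitone lam) (w : Equiv.Perm (Fin N)) :
    ∃ l : List ℕ, (∀ j ∈ l, j + 1 < N) ∧ permVec (permOfWord N l) lam = lam ∘ w ∧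
      l.length = ascNum (lam ∘ w) := by
  induction hn : ascNum (lam ∘ w) generalizing w with
  | zero =>
    refine ⟨[], by simp, ?_, rfl⟩
    have hw : lam ∘ w = lam := by
      refine eq_of_antitone_comp_perm hlam (antitone_of_adjacent fun i h => ?_)
      by_contra! hlt
      have := ascNum_comp_swapPerm_of_lt h hlt
      omega
    rw [hw]
    rfl
  | succ n ih =>
    obtain ⟨i, h, hlt⟩ : ∃ (i : ℕ) (h : i + 1 < N),
        (lam ∘ w) ⟨i, by omega⟩ < (lam ∘ w) ⟨i + 1, h⟩ := by
      by_contra! hle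
      have := ascNum_of_antitone (antitone_of_adjacent hle)
      omega
    have hasc := ascNum_comp_swapPerm_of_lt h hlt
    have e : lam ∘ ⇑(w * swapPerm N i) = (lam ∘ w) ∘ swapPerm N i := rfl
    obtain ⟨l, hl, hperm, hlen⟩ := ih (w * swapPerm N i) (by rw [e]; omega)
    refine ⟨i :: l, by simpa [h] using hl, ?_, by simp [hlen]⟩
    rw [permVec_permOfWord_cons, hperm, e, comp_swapPerm_comp_swapPerm]

/-- `IsDemazureAtom lam α f` says that `f` is obtained from `x^lam` by applying operators `π̂_i` along a
chain of strict ascents from `lam` to `α`. -/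
inductive IsDemazureAtom {N : ℕ} (lam : Fin N → ℕ) : (Fin N → ℕ) → KK N → Prop
  | base : IsDemazureAtom lam lam (∏ i, XV i ^ lam i)
  | step {α : Fin N → ℕ} {f : KK N} (i : ℕ) (h : i + 1 < N)
      (hα : α ⟨i, by omega⟩ < α ⟨i + 1, h⟩) (hf : IsDemazureAtom lam (α ∘ swapPerm N i) f) :
      IsDemazureAtom lam α (hatpiNat i f)

theorem ascNum_word {N : ℕ} {lam : Fin N → ℕ} (hlam : Antitone lam) (l : List ℕ)
    (hl : ∀ j ∈ l, j + 1 < N) :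
    ascNum (permVec (permOfWord N l) lam) ≤ l.length ∧
      (l.length ≤ ascNum (permVec (permOfWord N l) lam) →
        IsDemazureAtom lam (permVec (permOfWord N l) lam)
          (applyHatWord l (∏ i, XV (N := N) i ^ lam i))) := by
  induction l with
  | nil =>
    have e : permVec (permOfWord N []) lam = lam := rfl
    rw [e]
    exact ⟨(ascNum_of_antitone hlam).le, fun _ => .base⟩
  | cons j l ih =>
    have hj : j + 1 < N := hl j (by simp)
    obtain ⟨ih₁, ih₂⟩ := ih fun k hk => hl k (by simp [hk])
    rw [permVec_permOfWord_cons, List.length_cons]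
    generalize permVec (permOfWord N l) lam = β at *
    have hle := ascNum_comp_swapPerm_le hj β
    refine ⟨by omega, fun hlen => ?_⟩
    rcases lt_trichotomy (β ⟨j, by omega⟩) (β ⟨j + 1, hj⟩) with hβ | hβ | hβ
    · have := ascNum_comp_swapPerm_of_lt hj hβ
      omega
    · rw [comp_swapPerm_eq_self hj hβ] at hlen
      omega
    · refine IsDemazureAtom.step j hj ?_ ?_
      · simpa only [Function.comp_apply, swapPerm_left hj, swapPerm_right hj]
      · rw [comp_swapPerm_comp_swapPerm]
        exact ih₂ (by omega)

theorem IsDemazureAtom.exists {N : ℕ} {lam : Fin N → ℕ} (hlam : Antitone lam) (w : Equiv.Perm (Fin N)) :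
    ∃ f, IsDemazureAtom lam (lam ∘ w) f := by
  obtain ⟨l, hl, hperm, hlen⟩ := exists_word hlam w
  have h := (ascNum_word hlam l hl).2
  rw [hperm] at h
  exact ⟨_, h hlen.le⟩

/-- A minimal-length word of a shortest permutation taking `lam` to `α` computes an atom. -/
theorem IsDemazureAtom.of_shortest {N : ℕ} {lam : Fin N → ℕ} (hlam : Antitone lam) (l : List ℕ)
    (hl : ∀ j ∈ l, j + 1 < N) (hlen : l.length = invNum (permOfWord N l))
    (hmin : ∀ w' : Equiv.Perm (Fin N), permVec w' lam = permVec (permOfWord N l) lam →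
      invNum (permOfWord N l) ≤ invNum w') :
    IsDemazureAtom lam (permVec (permOfWord N l) lam) (applyHatWord l (∏ i, XV (N := N) i ^ lam i)) := by
  obtain ⟨l', hl', hperm, hlen'⟩ := exists_word hlam (permOfWord N l)⁻¹
  rw [← permVec_eq_comp] at hperm hlen'
  have h₁ := hmin _ hperm
  have h₂ := invNum_permOfWord_le l' hl'
  exact (ascNum_word hlam l hl).2 (by omega)

theorem IsDemazureAtom.exists_perm {N : ℕ} {lam α : Fin N → ℕ} {f : KK N} (hf : IsDemazureAtom lam α f) :
    ∃ w : Equiv.Perm (Fin N), α = lam ∘ w := by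
  induction hf with
  | base => exact ⟨1, rfl⟩
  | @step α f i h hα hf ih =>
    obtain ⟨w, hw⟩ := ih
    refine ⟨w * swapPerm N i, ?_⟩
    rw [Equiv.Perm.coe_mul, ← Function.comp_assoc, ← hw, comp_swapPerm_comp_swapPerm]

theorem IsDemazureAtom.cases_lt {N : ℕ} {lam α : Fin N → ℕ} {f : KK N} (hf : IsDemazureAtom lam α f) :
    (α = lam ∧ f = ∏ i, XV i ^ lam i) ∨
      ∃ (i : ℕ) (h : i + 1 < N) (g : KK N), α ⟨i, by omega⟩ < α ⟨i + 1, h⟩ ∧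
        IsDemazureAtom lam (α ∘ swapPerm N i) g ∧ f = hatpiNat i g := by
  cases hf with
  | base => exact .inl ⟨rfl, rfl⟩
  | step i h hα hf => exact .inr ⟨i, h, _, hα, hf, rfl⟩

theorem IsDemazureAtom.unique {N : ℕ} {lam : Fin N → ℕ} (hlam : Antitone lam) {α : Fin N → ℕ}
    {f g : KK N} (hf : IsDemazureAtom lam α f) (hg : IsDemazureAtom lam α g) : f = g := by
  induction hn : ascNum α using Nat.strong_induction_on generalizing α f g with
  | _ n ih =>
    subst hn
    obtain ⟨w, hw⟩ := hf.exists_perm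
    rcases hf.cases_lt with ⟨rfl, hf⟩ | ⟨i, hi, f', hαi, hf', rfl⟩ <;>
      rcases hg.cases_lt with ⟨hαlam, hg⟩ | ⟨j, hj, g', hαj, hg', rfl⟩
    · rw [hf, hg]
    · exact absurd (hlam (Fin.mk_le_mk.2 (Nat.le_succ j))) (not_le.2 hαj)
    · subst hαlam
      exact absurd (hlam (Fin.mk_le_mk.2 (Nat.le_succ i))) (not_le.2 hαi)
    wlog hij : i ≤ j generalizing i j f' g'
    · exact (this j hj g' hαj hg' hg i hi f' hαi hf' hf (by omega)).symm
    have hasci := ascNum_comp_swapPerm_of_lt hi hαi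
    have hascj := ascNum_comp_swapPerm_of_lt hj hαj
    obtain rfl | rfl | hij : i = j ∨ j = i + 1 ∨ i + 1 < j := by omega
    · rw [ih _ (by omega) hf' hg' rfl]
    · obtain ⟨k, hk⟩ := IsDemazureAtom.exists hlam
        (w * (swapPerm N i * swapPerm N (i + 1) * swapPerm N i))
      have e₁ : lam ∘ ⇑(w * (swapPerm N i * swapPerm N (i + 1) * swapPerm N i)) =
          ((α ∘ swapPerm N i) ∘ swapPerm N (i + 1)) ∘ swapPerm N i := by
        rw [hw]; rfl
      have e₂ : lam ∘ ⇑(w * (swapPerm N i * swapPerm N (i + 1) * swapPerm N i)) =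
          ((α ∘ swapPerm N (i + 1)) ∘ swapPerm N i) ∘ swapPerm N (i + 1) := by
        rw [hw, swapPerm_braid hj]; rfl
      have h₀ := swapPerm_of_ne hi hj (by omega) (by omega)
      have h₁ := swapPerm_of_ne (k := i) hj (by omega) (by omega) (by omega)
      have hf'' : IsDemazureAtom lam (α ∘ swapPerm N i) (hatpiNat (i + 1) (hatpiNat i k)) := by
        refine .step _ hj ?_ (.step _ hi ?_ (e₁ ▸ hk))
        · simpa only [Function.comp_apply, swapPerm_right hi, h₀] using hαi.trans hαj
        · simpa only [Function.comp_apply, swapPerm_left hi, h₀, h₁, swapPerm_left hj] using hαj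
      have hg'' : IsDemazureAtom lam (α ∘ swapPerm N (i + 1)) (hatpiNat i (hatpiNat (i + 1) k)) := by
        refine .step _ hi ?_ (.step _ hj ?_ (e₂ ▸ hk))
        · simpa only [Function.comp_apply, swapPerm_left hj, h₁] using hαi.trans hαj
        · simpa only [Function.comp_apply, swapPerm_right hi, h₀, h₁, swapPerm_right hj] using hαi
      rw [ih _ (by omega) hf' hf'' rfl, ih _ (by omega) hg' hg'' rfl, hatpiNat_braid hj]
    · obtain ⟨k, hk⟩ := IsDemazureAtom.exists hlam (w * (swapPerm N i * swapPerm N j))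
      have e₁ : lam ∘ ⇑(w * (swapPerm N i * swapPerm N j)) =
          (α ∘ swapPerm N i) ∘ swapPerm N j := by
        rw [hw]; rfl
      have e₂ : lam ∘ ⇑(w * (swapPerm N i * swapPerm N j)) =
          (α ∘ swapPerm N j) ∘ swapPerm N i := by
        rw [hw, swapPerm_commute hij hj]; rfl
      have hf'' : IsDemazureAtom lam (α ∘ swapPerm N i) (hatpiNat j k) := by
        refine .step _ hj ?_ (e₁ ▸ hk)
        rwa [Function.comp_apply, Function.comp_apply, swapPerm_of_ne hi _ (by omega) (by omega),
          swapPerm_of_ne hi _ (by omega) (by omega)]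
      have hg'' : IsDemazureAtom lam (α ∘ swapPerm N j) (hatpiNat i k) := by
        refine .step _ hi ?_ (e₂ ▸ hk)
        rwa [Function.comp_apply, Function.comp_apply, swapPerm_of_ne hj _ (by omega) (by omega),
          swapPerm_of_ne hj _ (by omega) (by omega)]
      rw [ih _ (by omega) hf' hf'' rfl, ih _ (by omega) hg' hg'' rfl, hatpiNat_comm hij hj]

theorem permK_prod_pow {N : ℕ} (w : Equiv.Perm (Fin N)) (α : Fin N → ℕ) :
    permK w (∏ k, XV k ^ α k) = ∏ k, XV (w k) ^ α k := by
  simp only [map_prod, map_pow, permK_XV]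

theorem permK_swapPerm_prod_pow {N i : ℕ} (h : i + 1 < N) {α : Fin N → ℕ}
    (hα : α ⟨i, by omega⟩ = α ⟨i + 1, h⟩) :
    permK (swapPerm N i) (∏ k, XV k ^ α k) = ∏ k, XV k ^ α k := by
  rw [permK_prod_pow]
  conv_rhs => rw [← Equiv.prod_comp (swapPerm N i)]
  refine Finset.prod_congr rfl fun k _ => ?_
  rw [show α (swapPerm N i k) = α k from congrFun (comp_swapPerm_eq_self h hα) k]

theorem IsDemazureAtom.hatpiNat_eq_zero {N : ℕ} {lam : Fin N → ℕ} (hlam : Antitone lam)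
    {α : Fin N → ℕ} {f : KK N} (hf : IsDemazureAtom lam α f) {i : ℕ} (hi : i + 1 < N)
    (hα : α ⟨i, by omega⟩ = α ⟨i + 1, hi⟩) : hatpiNat i f = 0 := by
  induction hn : ascNum α using Nat.strong_induction_on generalizing α f i with
  | _ n ih =>
    subst hn
    obtain ⟨w, hw⟩ := hf.exists_perm
    rcases hf.cases_lt with ⟨rfl, rfl⟩ | ⟨j, hj, g, hαj, hg, rfl⟩
    · rw [hatpiNat_eq_zero_iff hi, permK_swapPerm_prod_pow hi hα]
    have hasc := ascNum_comp_swapPerm_of_lt hj hαj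
    obtain rfl | rfl | rfl | hij | hij :
        i = j ∨ j = i + 1 ∨ i = j + 1 ∨ i + 1 < j ∨ j + 1 < i := by omega
    · exact absurd hα hαj.ne
    · have h₀ := swapPerm_of_ne hi hj (by omega) (by omega)
      have h₁ := swapPerm_of_ne (k := i) hj (by omega) (by omega) (by omega)
      have hlt : (α ∘ swapPerm N (i + 1)) ⟨i, by omega⟩ <
          (α ∘ swapPerm N (i + 1)) ⟨i + 1, hi⟩ := by
        simpa only [Function.comp_apply, h₁, swapPerm_left hj, hα] using hαj
      have hasc' := ascNum_comp_swapPerm_of_lt hi hlt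
      obtain ⟨k, hk⟩ := IsDemazureAtom.exists hlam (w * (swapPerm N (i + 1) * swapPerm N i))
      replace hk : IsDemazureAtom lam ((α ∘ swapPerm N (i + 1)) ∘ swapPerm N i) k := by
        rw [hw]; exact hk
      have hk₀ : hatpiNat (i + 1) k = 0 := by
        refine ih _ (by omega) hk hj ?_ rfl
        simpa only [Function.comp_apply, swapPerm_right hi, swapPerm_right hj, h₀, h₁] using hα
      rw [hg.unique hlam (.step i hi hlt hk), hatpiNat_braid hj, hk₀, hatpiNat_zero hi,
        hatpiNat_zero hj]
    · have h₀ := swapPerm_of_ne hj hi (by omega) (by omega)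
      have h₁ := swapPerm_of_ne (k := j) hi (by omega) (by omega) (by omega)
      have hlt : (α ∘ swapPerm N j) ⟨j + 1, hj⟩ <
          (α ∘ swapPerm N j) ⟨j + 1 + 1, hi⟩ := by
        simpa only [Function.comp_apply, h₀, swapPerm_right hj, ← hα] using hαj
      have hasc' := ascNum_comp_swapPerm_of_lt hi hlt
      obtain ⟨k, hk⟩ := IsDemazureAtom.exists hlam (w * (swapPerm N j * swapPerm N (j + 1)))
      replace hk : IsDemazureAtom lam ((α ∘ swapPerm N j) ∘ swapPerm N (j + 1)) k := by
        rw [hw]; exact hk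
      have hk₀ : hatpiNat j k = 0 := by
        refine ih _ (by omega) hk hj ?_ rfl
        simpa only [Function.comp_apply, swapPerm_left hj, swapPerm_left hi, h₀, h₁] using hα
      rw [hg.unique hlam (.step (j + 1) hi hlt hk), ← hatpiNat_braid hi, hk₀, hatpiNat_zero hi,
        hatpiNat_zero hj]
    · rw [hatpiNat_comm hij hj, ih _ (by omega) hg hi _ rfl, hatpiNat_zero hj]
      rwa [Function.comp_apply, Function.comp_apply, swapPerm_of_ne hj _ (by omega) (by omega),
        swapPerm_of_ne hj _ (by omega) (by omega)]
    · rw [← hatpiNat_comm hij hi, ih _ (by omega) hg hi _ rfl, hatpiNat_zero hj]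
      rwa [Function.comp_apply, Function.comp_apply, swapPerm_of_ne hj _ (by omega) (by omega),
        swapPerm_of_ne hj _ (by omega) (by omega)]

/-- If `A` gives the atoms of the rearrangements of `lam`, then `π̂_i` kills their sum. -/
theorem hatpiNat_sum_orbit {N : ℕ} {lam : Fin N → ℕ} (hlam : Antitone lam)
    {A : (Fin N → ℕ) → KK N} {s : Finset (Fin N → ℕ)}
    (hs : ∀ α, α ∈ s ↔ ∃ w : Equiv.Perm (Fin N), α = lam ∘ w)
    (hA : ∀ α ∈ s, IsDemazureAtom lam α (A α)) {i : ℕ} (hi : i + 1 < N) :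
    hatpiNat i (∑ α ∈ s, A α) = 0 := by
  have hmem : ∀ α ∈ s, α ∘ swapPerm N i ∈ s := fun α hα => by
    obtain ⟨w, rfl⟩ := (hs α).1 hα
    exact (hs _).2 ⟨w * swapPerm N i, rfl⟩
  have hadd : ∀ α ∈ s, α ⟨i, by omega⟩ < α ⟨i + 1, hi⟩ →
      hatpiNat i (A α) + hatpiNat i (A (α ∘ swapPerm N i)) = 0 := fun α hα hlt => by
    rw [(hA α hα).unique hlam (.step i hi hlt (hA _ (hmem α hα))), hatpiNat_hatpiNat hi,
      neg_add_cancel]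
  rw [hatpiNat_sum hi]
  refine Finset.sum_involution (fun α _ => α ∘ swapPerm N i) (fun α hα => ?_)
    (fun α hα hne heq => hne ?_) hmem fun α _ => comp_swapPerm_comp_swapPerm i α
  · rcases lt_trichotomy (α ⟨i, by omega⟩) (α ⟨i + 1, hi⟩) with hlt | heq | hlt
    · exact hadd α hα hlt
    · rw [comp_swapPerm_eq_self hi heq, (hA α hα).hatpiNat_eq_zero hlam hi heq, add_zero]
    · have h := hadd (α ∘ swapPerm N i) (hmem α hα)
        (by simpa only [Function.comp_apply, swapPerm_left hi, swapPerm_right hi] using hlt)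
      rwa [comp_swapPerm_comp_swapPerm, add_comm] at h
  · refine (hA α hα).hatpiNat_eq_zero hlam hi ?_
    have h := congrFun heq ⟨i + 1, hi⟩
    rwa [Function.comp_apply, swapPerm_right hi] at h

theorem permK_eq_self_of_swapPerm {N : ℕ} {f : KK N}
    (hf : ∀ i, i + 1 < N → permK (swapPerm N i) f = f) (w : Equiv.Perm (Fin N)) :
    permK w f = f := by
  cases N with
  | zero => rw [Subsingleton.elim w 1, permK_one]
  | succ n =>
    have hw : w ∈ Submonoid.closure (Set.range fun i : Fin n => Equiv.swap i.castSucc i.succ) := by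
      rw [Equiv.Perm.mclosure_swap_castSucc_succ]
      trivial
    induction hw using Submonoid.closure_induction with
    | mem x hx =>
      obtain ⟨i, rfl⟩ := hx
      have h : (i : ℕ) + 1 < n + 1 := by omega
      have e := hf i h
      rw [swapPerm, dif_pos h] at e
      exact e
    | one => exact permK_one f
    | mul x y _ _ hx hy => rw [permK_mul, hy, hx]

/-- The antisymmetrization of `x^ρ f`, where `ρ = (N-1, …, 1, 0)`. -/
def altSum {N : ℕ} (f : KK N) : KK N :=
  ∑ σ : Equiv.Perm (Fin N), ((Equiv.Perm.sign σ : ℤ) : KK N) *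
    permK σ ((∏ k, XV k ^ (N - 1 - (k : ℕ))) * f)

theorem altSum_sum {N : ℕ} {ι : Type*} (s : Finset ι) (f : ι → KK N) :
    altSum (∑ a ∈ s, f a) = ∑ a ∈ s, altSum (f a) := by
  simp only [altSum, Finset.mul_sum, map_sum]
  exact Finset.sum_comm

theorem altSum_of_symmetric {N : ℕ} {f : KK N} (hf : ∀ w, permK w f = f) :
    altSum f = altSum 1 * f := by
  simp only [altSum, map_mul, hf, mul_one, Finset.sum_mul, mul_assoc]

theorem altSum_prod_pow {N : ℕ} (α : Fin N → ℕ) :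
    altSum (∏ k, XV k ^ α k) =
      (Matrix.of fun i j : Fin N => XV i ^ (α j + (N - 1 - (j : ℕ))) : Matrix _ _ (KK N)).det := by
  rw [Matrix.det_apply', altSum]
  refine Finset.sum_congr rfl fun σ _ => ?_
  rw [← Finset.prod_mul_distrib]
  simp only [← pow_add, permK_prod_pow, Matrix.of_apply, add_comm]

theorem altSum_one {N : ℕ} :
    altSum 1 = (Matrix.of fun i j : Fin N => XV i ^ (N - 1 - (j : ℕ)) : Matrix _ _ (KK N)).det := by
  simpa using altSum_prod_pow (N := N) 0

theorem altSum_one_ne_zero {N : ℕ} : altSum (1 : KK N) ≠ 0 := by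
  have e : (Matrix.of fun i j : Fin N => XV i ^ (N - 1 - (j : ℕ)) : Matrix _ _ (KK N)) =
      Matrix.projVandermonde 1 XV := by
    ext i j
    rw [Matrix.projVandermonde_apply, Matrix.of_apply, Pi.one_apply, one_pow, one_mul, Fin.val_rev,
      Nat.sub_sub, add_comm 1]
  rw [altSum_one, e, Matrix.det_projVandermonde]
  refine Finset.prod_ne_zero_iff.2 fun i _ => Finset.prod_ne_zero_iff.2 fun j hj => ?_
  simpa using XV_sub_ne_zero (Finset.mem_Ioi.1 hj).ne

theorem sign_swapPerm {N i : ℕ} (h : i + 1 < N) : Equiv.Perm.sign (swapPerm N i) = -1 := by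
  rw [swapPerm, dif_pos h, Equiv.Perm.sign_swap (by simp [Fin.ext_iff])]

theorem altSum_hatpiNat {N i : ℕ} (h : i + 1 < N) (f : KK N) : altSum (hatpiNat i f) = 0 := by
  have hinv : permK (swapPerm N i) ((∏ k, XV k ^ (N - 1 - (k : ℕ))) * hatpiNat i f) =
      (∏ k, XV k ^ (N - 1 - (k : ℕ))) * hatpiNat i f := by
    have e : (∏ k : Fin N, XV k ^ (N - 1 - (k : ℕ))) * XV ⟨i + 1, h⟩ =
        ∏ k : Fin N, XV k ^ (N - 1 - (k : ℕ) + if k = ⟨i + 1, h⟩ then 1 else 0) := by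
      simp only [pow_add, Finset.prod_mul_distrib, pow_ite, pow_one, pow_zero,
        Finset.prod_ite_eq', Finset.mem_univ, if_true]
    have hsymm := permK_swapPerm_prod_pow h
      (α := fun k => N - 1 - (k : ℕ) + if k = ⟨i + 1, h⟩ then 1 else 0)
      (by simp only [Fin.mk.injEq, Nat.left_eq_add, one_ne_zero, if_false, if_true]; omega)
    rw [hatpiNat_eq h, mul_div_assoc, ← mul_assoc, e, map_mul, hsymm, map_div₀, map_sub, map_sub,
      permK_swapPerm_swapPerm, permK_XV, permK_XV, swapPerm_left h, swapPerm_right h,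
      ← neg_sub f, ← neg_sub (XV _) (XV ⟨i + 1, h⟩), neg_div_neg_eq]
  rw [altSum]
  refine Finset.sum_involution (fun σ _ => σ * swapPerm N i) (fun σ _ => ?_) (fun σ _ _ heq => ?_)
    (fun _ _ => Finset.mem_univ _) fun σ _ => by rw [mul_assoc, swapPerm_mul_self, mul_one]
  · rw [permK_mul, hinv, Equiv.Perm.sign_mul, sign_swapPerm h]
    simp
  · have := sign_swapPerm h
    rw [mul_eq_left.1 heq, Equiv.Perm.sign_one] at this
    exact absurd this (by decide)

/-- the sum of the Demazure atoms `𝒜_α` over the `S_N`-orbit of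
a partition `λ` equals the Schur polynomial `s_λ(x_1,…,x_N)`.  Here the atom
`𝒜_α = π̂_{w_α}(x^{α_+})` is encoded by the hypothesis `hA`: for each `α` in
the orbit, `A α = π̂_{j_1}(⋯ π̂_{j_d}(x^λ) ⋯)` for a reduced word
`[j_1,…,j_d]` (a word of minimal length, i.e. of length `ℓ(w)`) of the
shortest permutation `w` with `w(λ) = α`. -/
theorem sum_atoms_orbit_eq_schur (N : ℕ) (lam : Fin N → ℕ)
    (hlam : Antitone lam) (A : (Fin N → ℕ) → KK N)
    (hA : ∀ α ∈ Finset.image (fun w : Equiv.Perm (Fin N) => permVec w lam)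
        Finset.univ,
      ∃ (w : Equiv.Perm (Fin N)) (l : List ℕ),
        permVec w lam = α ∧
        (∀ w' : Equiv.Perm (Fin N), permVec w' lam = α → invNum w ≤ invNum w') ∧
        permOfWord N l = w ∧ l.length = invNum w ∧ (∀ j ∈ l, j + 1 < N) ∧
        A α = applyHatWord l (∏ i, XV (N := N) i ^ lam i)) :
    ∑ α ∈ Finset.image (fun w : Equiv.Perm (Fin N) => permVec w lam)
        Finset.univ, A α = schur lam := by
  set s := Finset.image (fun w : Equiv.Perm (Fin N) => permVec w lam) Finset.univ with hs_def
  have hs : ∀ α, α ∈ s ↔ ∃ w : Equiv.Perm (Fin N), α = lam ∘ w := fun α => by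
    rw [hs_def, Finset.mem_image]
    exact ⟨fun ⟨w, _, hw⟩ => ⟨w⁻¹, hw.symm⟩,
      fun ⟨w, hw⟩ => ⟨w⁻¹, Finset.mem_univ _, by rw [hw, permVec_eq_comp, inv_inv]⟩⟩
  have hatom : ∀ α ∈ s, IsDemazureAtom lam α (A α) := fun α hα => by
    obtain ⟨w, l, rfl, hmin, rfl, hlen, hl, hAα⟩ := hA α hα
    rw [hAα]
    exact .of_shortest hlam l hl hlen hmin
  have hsymm : ∀ w, permK w (∑ α ∈ s, A α) = ∑ α ∈ s, A α :=
    permK_eq_self_of_swapPerm fun i hi =>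
      (hatpiNat_eq_zero_iff hi _).1 (hatpiNat_sum_orbit hlam hs hatom hi)
  have hlam_mem : lam ∈ s := (hs lam).2 ⟨1, rfl⟩
  have hsum : altSum (∑ α ∈ s, A α) = altSum (∏ i, XV i ^ lam i) := by
    rw [altSum_sum, Finset.sum_eq_single_of_mem lam hlam_mem,
      (hatom lam hlam_mem).unique hlam .base]
    intro α hα hne
    rcases (hatom α hα).cases_lt with ⟨h, _⟩ | ⟨i, hi, g, _, _, hg⟩
    · exact absurd h hne
    · rw [hg, altSum_hatpiNat hi]
  rw [schur, ← altSum_prod_pow, ← altSum_one, ← hsum, altSum_of_symmetric hsymm,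
    mul_div_cancel_left₀ _ altSum_one_ne_zero]

end
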